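/- Fix r ∈ (0,1), β ∈ (0,∞), and α > 0, and for each λ > 0 let ν_λ denote the unique minimizer over (0,∞) of the reduced potential V_{α,r,λ}. Then: (i) if α < α_c(r), then ν_λ → ∞ and V_{α,r,0}(ν_λ) → 0 as λ ↓ 0; (ii) if α > α_c(r), then ν_λ remains bounded as λ ↓ 0 and converges to the unique minimizer ν₀ < ∞ of the ridgeless potential V_{α,r,0}, and the ridgeless value V_{α,r,0}(ν₀) is strictly positive. -/

import Mathlib

open MeasureTheory ProbabilityTheory Filter Topology

noncomputable section

/-- The logistic loss `ℓ(t) = log(1 + e^{-t})`. -/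
def logisticLoss (t : ℝ) : ℝ := Real.log (1 + Real.exp (-t))

/-- The softplus `φ_β(t) = β⁻¹ log(1 + e^{β t})`. -/
def softplus (β t : ℝ) : ℝ := Real.log (1 + Real.exp (β * t)) / β

/-- The scalar TAM functional `c_r(ν) = min_μ { μ + (1/r)·E[φ_β(νZ − μ)] }`. -/
def scalarTAM (r β ν : ℝ) : ℝ :=
  ⨅ μ : ℝ, (μ + (1 / r) * ∫ z, softplus β (ν * z - μ) ∂gaussianReal 0 1)

/-- The scalar Moreau envelope `M_r(ν,χ)`. -/
def scalarMoreau (r β ν χ : ℝ) : ℝ :=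
  ∫ g, (⨅ s : ℝ, ((s - ν * g) ^ 2 / (2 * χ) + logisticLoss (s - scalarTAM r β ν)))
    ∂gaussianReal 0 1

/-- The scalar saddle potential `P_{α,r,λ}(ν,χ)`. -/
def saddlePotential (α r β lam ν χ : ℝ) : ℝ :=
  lam / 2 * ν ^ 2 - ν ^ 2 / (2 * α * χ) + scalarMoreau r β ν χ

/-- The reduced potential `V_{α,r,λ}(ν) = sup_{χ>0} P_{α,r,λ}(ν,χ)`; `λ = 0` gives
the ridgeless potential `V_{α,r,0}`. -/
def reducedPotential (α r β lam ν : ℝ) : ℝ :=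
  ⨆ χ : {x : ℝ // 0 < x}, saddlePotential α r β lam ν χ

/-- The standard normal CDF `Φ`. -/
def Phi (x : ℝ) : ℝ := (gaussianReal 0 1 (Set.Iic x)).toReal

/-- The standard normal quantile function `Φ⁻¹`. -/
def PhiInv (p : ℝ) : ℝ := sInf {x : ℝ | p ≤ Phi x}

/-- The standard normal density `φ`. -/
def normPDF (x : ℝ) : ℝ := Real.exp (-x ^ 2 / 2) / Real.sqrt (2 * Real.pi)

/-- `κ_r = φ(Φ⁻¹(1−r))/r`. -/
def kappaR (r : ℝ) : ℝ := normPDF (PhiInv (1 - r)) / r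

/-- The critical load `α_c(r) = 1/((1+κ_r²)Φ(κ_r) + κ_r φ(κ_r))`. -/
def criticalLoad (r : ℝ) : ℝ :=
  1 / ((1 + kappaR r ^ 2) * Phi (kappaR r) + kappaR r * normPDF (kappaR r))
/-! ### Gaussian preliminaries -/

/-- The standard Gaussian measure. -/
abbrev gam : Measure ℝ := gaussianReal 0 1

instance gam_openPos : (gaussianReal 0 1).IsOpenPosMeasure :=
  (gaussianReal_absolutelyContinuous' 0 one_ne_zero).isOpenPosMeasure

lemma integrable_sq_gam : Integrable (fun g : ℝ => g ^ 2) gam := by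
  have h := (memLp_id_gaussianReal' (μ := 0) (v := 1) 2 (by simp)).integrable_sq
  simpa using h

lemma integrable_id_gam : Integrable (fun g : ℝ => g) gam := by
  have h := (memLp_id_gaussianReal' (μ := 0) (v := 1) 1 (by simp)).integrable le_rfl
  exact h

lemma integral_id_gam : ∫ g, g ∂gam = 0 := integral_id_gaussianReal

/-- Continuous functions of at most quadratic growth are Gaussian integrable. -/
lemma integ_of_bound {f : ℝ → ℝ} (hf : Continuous f) (A B : ℝ)
    (h : ∀ g, |f g| ≤ A + B * g ^ 2) : Integrable f gam := by
  have h1 : Integrable (fun g : ℝ => A + B * g ^ 2) gam :=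
    (integrable_const A).add (integrable_sq_gam.const_mul B)
  exact h1.mono' hf.aestronglyMeasurable (ae_of_all _ h)

lemma normPDF_eq (x : ℝ) : normPDF x = gaussianPDFReal 0 1 x := by
  unfold normPDF
  rw [gaussianPDFReal_def]
  simp
  ring

lemma normPDF_pos (x : ℝ) : 0 < normPDF x := by
  rw [normPDF_eq]; exact gaussianPDFReal_pos _ _ _ one_ne_zero

lemma normPDF_hasDerivAt (x : ℝ) : HasDerivAt normPDF (-x * normPDF x) x := by
  unfold normPDF
  have h : HasDerivAt (fun x : ℝ => -x ^ 2 / 2) (-x) x := by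
    have := ((hasDerivAt_pow 2 x).neg).div_const 2
    exact this.congr_deriv (by push_cast; ring)
  have := (h.exp).div_const (Real.sqrt (2 * Real.pi))
  exact this.congr_deriv (by ring)

lemma integral_gam (f : ℝ → ℝ) : ∫ g, f g ∂gam = ∫ g, normPDF g * f g := by
  rw [integral_gaussianReal_eq_integral_smul one_ne_zero]
  simp [normPDF_eq]

lemma tendsto_poly_normPDF (a b : ℝ) :
    Tendsto (fun x : ℝ => (a + b * x) * normPDF x) (cocompact ℝ) (𝓝 0) := by
  have h0 : Tendsto (fun x : ℝ => Real.exp (-(1/2) * x ^ 2)) (cocompact ℝ) (𝓝 0) := by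
    have := tendsto_rpow_abs_mul_exp_neg_mul_sq_cocompact (a := 1/2) (by norm_num) 0
    simpa using this
  have h1 : Tendsto (fun x : ℝ => |x| * Real.exp (-(1/2) * x ^ 2)) (cocompact ℝ) (𝓝 0) := by
    have := tendsto_rpow_abs_mul_exp_neg_mul_sq_cocompact (a := 1/2) (by norm_num) 1
    simpa using this
  have h2 : Tendsto (fun x : ℝ => x * Real.exp (-(1/2) * x ^ 2)) (cocompact ℝ) (𝓝 0) := by
    rw [tendsto_zero_iff_abs_tendsto_zero]
    refine h1.congr fun x => ?_
    simp [abs_mul]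
  have h3 := ((h0.const_mul a).add (h2.const_mul b)).div_const (Real.sqrt (2 * Real.pi))
  simp only [mul_zero, add_zero, zero_div] at h3
  refine h3.congr fun x => ?_
  unfold normPDF
  rw [show -(1/2) * x ^ 2 = -x ^ 2 / 2 by ring]
  ring

lemma integrable_gam_iff {f : ℝ → ℝ} : Integrable f gam ↔ Integrable (fun g => normPDF g * f g) := by
  unfold gam
  rw [gaussianReal_of_var_ne_zero 0 one_ne_zero, gaussianPDF_def]
  rw [integrable_withDensity_iff_integrable_smul' (by fun_prop) (by simp)]
  refine integrable_congr (ae_of_all _ fun x => ?_)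
  simp [normPDF_eq, ENNReal.toReal_ofReal (gaussianPDFReal_nonneg 0 1 x)]

lemma setIntegral_gam (f : ℝ → ℝ) (s : Set ℝ) (hs : MeasurableSet s) :
    ∫ g in s, f g ∂gam = ∫ g in s, normPDF g * f g := by
  rw [← integral_indicator hs, ← integral_indicator hs, integral_gam]
  refine integral_congr_ae (ae_of_all _ fun x => ?_)
  by_cases h : x ∈ s <;> simp [h]

lemma Phi_eq_cdf (x : ℝ) : Phi x = cdf gam x := by
  rw [cdf_eq_real]; rfl

lemma gam_singleton (x : ℝ) : gam {x} = 0 :=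
  gaussianReal_absolutelyContinuous 0 one_ne_zero (by simp)

lemma continuous_Phi : Continuous Phi := by
  have he : Phi = cdf gam := funext Phi_eq_cdf
  rw [he, continuous_iff_continuousAt]
  intro x
  rw [(monotone_cdf gam).continuousAt_iff_leftLim_eq_rightLim, StieltjesFunction.rightLim_eq]
  have h := (cdf gam).measure_singleton x
  rw [measure_cdf, gam_singleton] at h
  have h2 := (monotone_cdf gam).leftLim_le (le_refl x)
  have h3 := ENNReal.ofReal_eq_zero.1 h.symm
  linarith

lemma Phi_PhiInv (p : ℝ) (h0 : 0 < p) (h1 : p < 1) : Phi (PhiInv p) = p := by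
  have hb : Tendsto Phi atBot (𝓝 0) := by
    rw [show Phi = cdf gam from funext Phi_eq_cdf]; exact tendsto_cdf_atBot gam
  have ht : Tendsto Phi atTop (𝓝 1) := by
    rw [show Phi = cdf gam from funext Phi_eq_cdf]; exact tendsto_cdf_atTop gam
  have hm : Monotone Phi := by
    rw [show Phi = cdf gam from funext Phi_eq_cdf]; exact monotone_cdf gam
  obtain ⟨a, ha⟩ := (hb.eventually (gt_mem_nhds h0)).exists
  obtain ⟨b, hb'⟩ := (ht.eventually (lt_mem_nhds h1)).exists
  obtain ⟨q, hq⟩ := mem_range_of_exists_le_of_exists_ge continuous_Phi ⟨a, ha.le⟩ ⟨b, hb'.le⟩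
  have hbd : BddBelow {x : ℝ | p ≤ Phi x} := by
    refine ⟨a, fun x hx => ?_⟩
    by_contra hlt
    have := hm (not_le.1 hlt).le
    have hx' : p ≤ Phi x := hx
    linarith
  have hcl : IsClosed {x : ℝ | p ≤ Phi x} := isClosed_le continuous_const continuous_Phi
  have hmem : PhiInv p ∈ {x : ℝ | p ≤ Phi x} := hcl.csInf_mem ⟨q, hq.ge⟩ hbd
  refine le_antisymm ?_ hmem
  rw [← hq]
  refine hm (csInf_le ?_ ?_)
  · rw [hq]; exact hbd
  · simp

lemma gam_Ioi (q : ℝ) : (gam (Set.Ioi q)).toReal = 1 - Phi q := by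
  have h := prob_compl_eq_one_sub (μ := gam) (measurableSet_Iic (a := q))
  rw [Set.compl_Iic] at h
  rw [h, ENNReal.toReal_sub_of_le prob_le_one (by simp)]
  simp [Phi]

lemma integral_Ioi_id (q : ℝ) : ∫ z in Set.Ioi q, z ∂gam = normPDF q := by
  rw [setIntegral_gam _ _ measurableSet_Ioi]
  have hd : ∀ x ∈ Set.Ici q, HasDerivAt (fun x => -normPDF x) (normPDF x * x) x := by
    intro x _
    exact (normPDF_hasDerivAt x).neg.congr_deriv (by ring)
  have ht : Tendsto (fun x => -normPDF x) atTop (𝓝 0) := by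
    have := (tendsto_poly_normPDF (-1) 0).mono_left atTop_le_cocompact
    simpa using this
  have := integral_Ioi_of_hasDerivAt_of_tendsto' hd
    ((integrable_gam_iff.1 integrable_id_gam).integrableOn) ht
  rw [this]; ring

/-- The closed form of `E[(κ - G)_+^2]`. -/
lemma integral_pos_sq (k : ℝ) : ∫ g, (max (k - g) 0) ^ 2 ∂gam =
    (1 + k ^ 2) * Phi k + k * normPDF k := by
  have h1 : ∀ g, (max (k - g) 0) ^ 2 = (Set.Iic k).indicator (fun g => (k - g) ^ 2) g := by
    intro g
    by_cases h : g ≤ k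
    · rw [Set.indicator_of_mem (by exact h), max_eq_left (by linarith)]
    · rw [Set.indicator_of_notMem (by exact h), max_eq_right (by linarith)]; simp
  simp_rw [h1]
  rw [integral_indicator measurableSet_Iic]
  have hi : Integrable (fun g : ℝ => -1 - 2 * k * g + g ^ 2) gam := by
    refine ((integrable_const _).sub (integrable_id_gam.const_mul _)).add integrable_sq_gam
  have h2 : ∀ g : ℝ, (k - g) ^ 2 = (1 + k ^ 2) + (-1 - 2 * k * g + g ^ 2) := by intro g; ring
  simp_rw [h2]
  rw [integral_add (integrable_const _).integrableOn hi.integrableOn]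
  congr 1
  · simp [Phi, Measure.real]; ring
  · rw [setIntegral_gam _ _ measurableSet_Iic]
    have hd : ∀ x ∈ Set.Iic k, HasDerivAt (fun x => (2 * k + (-1) * x) * normPDF x)
        (normPDF x * (-1 - 2 * k * x + x ^ 2)) x := by
      intro x _
      have h3 : HasDerivAt (fun x : ℝ => 2 * k + (-1) * x) (-1) x := by
        simpa using ((hasDerivAt_id x).const_mul (-1)).const_add (2 * k)
      exact (h3.mul (normPDF_hasDerivAt x)).congr_deriv (by ring)
    have ht := (tendsto_poly_normPDF (2 * k) (-1)).mono_left atBot_le_cocompact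
    rw [integral_Iic_of_hasDerivAt_of_tendsto' hd ((integrable_gam_iff.1 hi).integrableOn) ht]
    ring

/-! ### Softplus and logistic loss -/

/-- The unit softplus. -/
def spl (t : ℝ) : ℝ := Real.log (1 + Real.exp t)

lemma spl_hasDerivAt (t : ℝ) : HasDerivAt spl (Real.sigmoid t) t := by
  have h := ((Real.hasDerivAt_exp t).const_add 1).log (by positivity)
  refine h.congr_deriv ?_
  rw [Real.sigmoid_def, Real.exp_neg]
  field_simp
  ring

lemma spl_continuous : Continuous spl :=
  continuous_iff_continuousAt.2 fun t => (spl_hasDerivAt t).continuousAt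

lemma spl_strictConvex : StrictConvexOn ℝ Set.univ spl := by
  refine StrictMono.strictConvexOn_univ_of_deriv spl_continuous ?_
  rw [show deriv spl = Real.sigmoid from funext fun t => (spl_hasDerivAt t).deriv]
  exact Real.sigmoid_strictMono

lemma spl_pos (t : ℝ) : 0 < spl t := Real.log_pos (by linarith [Real.exp_pos t])

lemma spl_ge (t : ℝ) : t ≤ spl t := by
  unfold spl
  rw [Real.le_log_iff_exp_le (by positivity)]
  linarith

lemma spl_mono : Monotone spl := by
  intro a b h
  unfold spl
  exact Real.log_le_log (by positivity) (by linarith [Real.exp_le_exp.2 h])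

lemma spl_le (t : ℝ) : spl t ≤ max t 0 + Real.log 2 := by
  unfold spl
  rw [Real.log_le_iff_le_exp (by positivity), Real.exp_add, Real.exp_log (by norm_num)]
  have h1 := Real.exp_le_exp.2 (le_max_left t 0)
  have h2 := Real.exp_le_exp.2 (le_max_right t 0)
  rw [Real.exp_zero] at h2
  linarith

lemma spl_tangent (m s : ℝ) : spl m + Real.sigmoid m * (s - m) ≤ spl s := by
  have hc := spl_strictConvex.convexOn
  rcases lt_trichotomy m s with h | h | h
  · have := hc.le_slope_of_hasDerivAt (Set.mem_univ m) (Set.mem_univ s) h (spl_hasDerivAt m)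
    rw [slope_def_field, le_div_iff₀ (by linarith)] at this
    linarith
  · simp [h]
  · have := hc.slope_le_of_hasDerivAt (Set.mem_univ s) (Set.mem_univ m) h (spl_hasDerivAt m)
    rw [slope_def_field, div_le_iff₀ (by linarith)] at this
    nlinarith

lemma ell_eq (t : ℝ) : logisticLoss t = spl (-t) := rfl

lemma ell_continuous : Continuous logisticLoss := spl_continuous.comp continuous_neg

lemma ell_pos (t : ℝ) : 0 < logisticLoss t := spl_pos _

lemma ell_ge (t : ℝ) : -t ≤ logisticLoss t := spl_ge _

lemma ell_anti : Antitone logisticLoss := fun _ _ h => spl_mono (neg_le_neg h)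

lemma ell_le (t : ℝ) : logisticLoss t ≤ |t| + Real.log 2 := by
  refine (spl_le _).trans ?_
  have : max (-t) 0 ≤ |t| := max_le (neg_le_abs t) (abs_nonneg t)
  linarith

lemma ell_abs_le (t : ℝ) : |logisticLoss t| ≤ |t| + 1 := by
  rw [abs_of_pos (ell_pos t)]
  have : Real.log 2 ≤ 1 := by linarith [Real.log_two_lt_d9]
  linarith [ell_le t]

/-- Minus the derivative of the logistic loss. -/
def pl (t : ℝ) : ℝ := Real.sigmoid (-t)

lemma pl_pos (t : ℝ) : 0 < pl t := Real.sigmoid_pos _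
lemma pl_le_one (t : ℝ) : pl t ≤ 1 := Real.sigmoid_le_one _
lemma pl_anti : Antitone pl := fun _ _ h => Real.sigmoid_le (neg_le_neg h)
lemma pl_continuous : Continuous pl := continuous_sigmoid.comp continuous_neg

lemma ell_tangent (m s : ℝ) : logisticLoss m - pl m * (s - m) ≤ logisticLoss s := by
  have := spl_tangent (-m) (-s)
  rw [ell_eq, ell_eq, pl]
  linarith

lemma ell_strict {a b t s : ℝ} (hab : a ≠ b) (ht : 0 < t) (hs : 0 < s) (hts : t + s = 1) :
    logisticLoss (t * a + s * b) < t * logisticLoss a + s * logisticLoss b := by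
  have := spl_strictConvex.2 (Set.mem_univ (-a)) (Set.mem_univ (-b))
    (fun h => hab (neg_injective h)) ht hs hts
  simp only [smul_eq_mul] at this
  rw [ell_eq, ell_eq, ell_eq, show -(t * a + s * b) = t * -a + s * -b by ring]
  exact this

lemma ell_convex (a b : ℝ) {t s : ℝ} (ht : 0 < t) (hs : 0 < s) (hts : t + s = 1) :
    logisticLoss (t * a + s * b) ≤ t * logisticLoss a + s * logisticLoss b := by
  by_cases h : a = b
  · subst h
    rw [← add_mul, ← add_mul, hts, one_mul, one_mul]
  · exact (ell_strict h ht hs hts).le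

lemma ell_tendsto : Tendsto logisticLoss atTop (𝓝 0) := by
  have h1 : Tendsto (fun t : ℝ => 1 + Real.exp (-t)) atTop (𝓝 (1 + 0)) :=
    Real.tendsto_exp_neg_atTop_nhds_zero.const_add 1
  have h2 := h1.log (by norm_num)
  rw [add_zero, Real.log_one] at h2
  exact h2

/-! ### The scalar TAM functional -/

lemma softplus_eq (β t : ℝ) : softplus β t = spl (β * t) / β := rfl

lemma softplus_ge {β : ℝ} (hβ : 0 < β) (t : ℝ) : t ≤ softplus β t := by
  rw [softplus_eq, le_div_iff₀ hβ]
  linarith [spl_ge (β * t)]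

lemma softplus_pos {β : ℝ} (hβ : 0 < β) (t : ℝ) : 0 < softplus β t :=
  div_pos (spl_pos _) hβ

lemma softplus_le {β : ℝ} (hβ : 0 < β) (t : ℝ) : softplus β t ≤ max t 0 + Real.log 2 / β := by
  rw [softplus_eq, div_le_iff₀ hβ]
  have h := spl_le (β * t)
  have h2 : max (β * t) 0 = max t 0 * β := by
    rw [max_mul_of_nonneg _ _ hβ.le]; simp [mul_comm]
  rw [add_mul, div_mul_cancel₀ _ hβ.ne']
  linarith

lemma softplus_continuous (β : ℝ) : Continuous (softplus β) := by
  have : Continuous fun t => spl (β * t) / β :=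
    (spl_continuous.comp (continuous_const.mul continuous_id)).div_const β
  exact this

lemma softplus_convex {β : ℝ} (hβ : 0 < β) (a b : ℝ) {t s : ℝ} (ht : 0 ≤ t) (hs : 0 ≤ s)
    (hts : t + s = 1) : softplus β (t * a + s * b) ≤ t * softplus β a + s * softplus β b := by
  have h := spl_strictConvex.convexOn.2 (Set.mem_univ (β * a)) (Set.mem_univ (β * b)) ht hs hts
  simp only [smul_eq_mul] at h
  rw [softplus_eq, softplus_eq, softplus_eq, div_le_iff₀ hβ,
    show β * (t * a + s * b) = t * (β * a) + s * (β * b) by ring]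
  refine h.trans (le_of_eq ?_)
  field_simp

lemma abs_le_one_add_sq (g : ℝ) : |g| ≤ 1 + g ^ 2 := by
  rw [← sq_abs]; nlinarith [sq_nonneg (|g| - 1), abs_nonneg g]

lemma integrable_softplus {β : ℝ} (hβ : 0 < β) (ν μ : ℝ) :
    Integrable (fun z => softplus β (ν * z - μ)) gam := by
  refine integ_of_bound ((softplus_continuous β).comp (by fun_prop))
    (|ν| + |μ| + Real.log 2 / β) |ν| fun g => ?_
  rw [abs_of_pos (softplus_pos hβ _)]
  refine (softplus_le hβ _).trans ?_
  have h1 : max (ν * g - μ) 0 ≤ |ν| * |g| + |μ| := by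
    rw [← abs_mul]
    refine max_le ?_ (by positivity)
    linarith [le_abs_self (ν * g), neg_abs_le μ]
  nlinarith [abs_le_one_add_sq g, abs_nonneg ν]

/-- The objective of the TAM functional. -/
def tamF (r β ν μ : ℝ) : ℝ := μ + (1 / r) * ∫ z, softplus β (ν * z - μ) ∂gaussianReal 0 1

lemma scalarTAM_eq (r β ν : ℝ) : scalarTAM r β ν = ⨅ μ, tamF r β ν μ := rfl

lemma integral_Ioi_affine {r : ℝ} (hr0 : 0 < r) (hr1 : r < 1) (ν μ : ℝ) :
    ∫ z in Set.Ioi (PhiInv (1 - r)), (ν * z - μ) ∂gam = ν * (r * kappaR r) - μ * r := by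
  rw [integral_sub (integrable_id_gam.const_mul ν).integrableOn (integrable_const _).integrableOn,
    integral_const_mul, integral_Ioi_id]
  have : gam.real (Set.Ioi (PhiInv (1 - r))) = r := by
    rw [Measure.real, gam_Ioi, Phi_PhiInv _ (by linarith) (by linarith)]; ring
  simp only [integral_const, measureReal_restrict_apply_univ, this, smul_eq_mul]
  rw [kappaR, mul_div_cancel₀ _ hr0.ne']
  ring

lemma tamF_ge {r β : ℝ} (hr0 : 0 < r) (hr1 : r < 1) (hβ : 0 < β) (ν μ : ℝ) :
    kappaR r * ν ≤ tamF r β ν μ := by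
  have h1 : ∫ z in Set.Ioi (PhiInv (1 - r)), (ν * z - μ) ∂gam ≤
      ∫ z, softplus β (ν * z - μ) ∂gam := by
    rw [← integral_indicator measurableSet_Ioi]
    refine integral_mono ?_ (integrable_softplus hβ ν μ) fun z => ?_
    · exact ((integrable_id_gam.const_mul ν).sub (integrable_const _)).indicator measurableSet_Ioi
    · refine Set.indicator_apply_le' (fun _ => softplus_ge hβ _) (fun _ => (softplus_pos hβ _).le)
  rw [integral_Ioi_affine hr0 hr1] at h1
  have h2 := mul_le_mul_of_nonneg_left h1 (one_div_pos.2 hr0).le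
  have h3 : 1 / r * (ν * (r * kappaR r) - μ * r) = kappaR r * ν - μ := by
    field_simp
  unfold tamF
  linarith

lemma tam_bdd {r β : ℝ} (hr0 : 0 < r) (hr1 : r < 1) (hβ : 0 < β) (ν : ℝ) :
    BddBelow (Set.range (tamF r β ν)) :=
  ⟨kappaR r * ν, by rintro _ ⟨μ, rfl⟩; exact tamF_ge hr0 hr1 hβ ν μ⟩

lemma tam_ge {r β : ℝ} (hr0 : 0 < r) (hr1 : r < 1) (hβ : 0 < β) (ν : ℝ) :
    kappaR r * ν ≤ scalarTAM r β ν := le_ciInf fun μ => tamF_ge hr0 hr1 hβ ν μ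

lemma tam_le {r β : ℝ} (hr0 : 0 < r) (hr1 : r < 1) (hβ : 0 < β) {ν : ℝ} (hν : 0 < ν) :
    scalarTAM r β ν ≤ kappaR r * ν + (1 / r) * (Real.log 2 / β) := by
  refine (ciInf_le (tam_bdd hr0 hr1 hβ ν) (ν * PhiInv (1 - r))).trans ?_
  set q := PhiInv (1 - r) with hq
  have h1 : ∫ z, softplus β (ν * z - ν * q) ∂gam ≤
      ∫ z, ((Set.Ioi q).indicator (fun z => ν * z - ν * q) z + Real.log 2 / β) ∂gam := by
    refine integral_mono (integrable_softplus hβ ν _) ?_ fun z => ?_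
    · exact (((integrable_id_gam.const_mul ν).sub (integrable_const _)).indicator
        measurableSet_Ioi).add (integrable_const _)
    · refine (softplus_le hβ _).trans (add_le_add ?_ le_rfl)
      by_cases h : q < z
      · rw [Set.indicator_of_mem (by exact h), max_eq_left]
        nlinarith
      · rw [Set.indicator_of_notMem (by exact h), max_eq_right]
        nlinarith
  have hi : Integrable ((Set.Ioi q).indicator (fun z => ν * z - ν * q)) gam :=
    ((integrable_id_gam.const_mul ν).sub (integrable_const _)).indicator measurableSet_Ioi
  rw [integral_add hi (integrable_const _), integral_indicator measurableSet_Ioi, hq,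
        integral_Ioi_affine hr0 hr1] at h1
  simp only [integral_const, probReal_univ, one_smul] at h1
  have h2 := mul_le_mul_of_nonneg_left h1 (one_div_pos.2 hr0).le
  have h3 : 1 / r * (ν * (r * kappaR r) - ν * PhiInv (1 - r) * r + Real.log 2 / β)
    = kappaR r * ν - ν * PhiInv (1 - r) + 1 / r * (Real.log 2 / β) := by
    field_simp
  unfold tamF
  linarith

lemma kappa_pos {r : ℝ} (hr0 : 0 < r) : 0 < kappaR r := div_pos (normPDF_pos _) hr0

lemma tam_nonneg {r β : ℝ} (hr0 : 0 < r) (hr1 : r < 1) (hβ : 0 < β) {ν : ℝ} (hν : 0 < ν) :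
    0 ≤ scalarTAM r β ν :=
  (mul_pos (kappa_pos hr0) hν).le.trans (tam_ge hr0 hr1 hβ ν)

lemma tam_convex {r β : ℝ} (hr0 : 0 < r) (hr1 : r < 1) (hβ : 0 < β) (a b : ℝ) {t s : ℝ}
    (ht : 0 < t) (hs : 0 < s) (hts : t + s = 1) :
    scalarTAM r β (t * a + s * b) ≤ t * scalarTAM r β a + s * scalarTAM r β b := by
  have key : ∀ m n, scalarTAM r β (t * a + s * b) ≤ t * tamF r β a m + s * tamF r β b n := by
    intro m n
    refine (ciInf_le (tam_bdd hr0 hr1 hβ _) (t * m + s * n)).trans ?_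
    have h1 : ∫ z, softplus β ((t * a + s * b) * z - (t * m + s * n)) ∂gam ≤
        ∫ z, (t * softplus β (a * z - m) + s * softplus β (b * z - n)) ∂gam := by
      refine integral_mono (integrable_softplus hβ _ _)
        (((integrable_softplus hβ _ _).const_mul t).add
          ((integrable_softplus hβ _ _).const_mul s)) fun z => ?_
      have := softplus_convex hβ (a * z - m) (b * z - n) ht.le hs.le hts
      refine le_trans (le_of_eq ?_) this
      congr 1; ring
    rw [integral_add ((integrable_softplus hβ _ _).const_mul t)
          ((integrable_softplus hβ _ _).const_mul s), integral_const_mul, integral_const_mul] at h1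
    have h2 := mul_le_mul_of_nonneg_left h1 (one_div_pos.2 hr0).le
    unfold tamF
    linarith
  have k2 : ∀ n, scalarTAM r β (t * a + s * b) ≤ t * scalarTAM r β a + s * tamF r β b n := by
    intro n
    have : (scalarTAM r β (t * a + s * b) - s * tamF r β b n) / t ≤ scalarTAM r β a := by
      refine le_ciInf fun m => ?_
      rw [div_le_iff₀ ht]
      have := key m n
      unfold tamF at this ⊢
      linarith
    rw [div_le_iff₀ ht] at this
    linarith
  have : (scalarTAM r β (t * a + s * b) - t * scalarTAM r β a) / s ≤ scalarTAM r β b := by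
    refine le_ciInf fun m => ?_
    rw [div_le_iff₀ hs]
    have := k2 m
    unfold tamF at this
    linarith
  rw [div_le_iff₀ hs] at this
  linarith

/-! ### The proximal map of the logistic loss -/

lemma exists_dP (χ x : ℝ) : ∃ d, 0 ≤ χ → d = χ * pl (x + d) := by
  by_cases h : 0 ≤ χ
  · have hc : Continuous fun d => d - χ * pl (x + d) :=
      continuous_id.sub (continuous_const.mul (pl_continuous.comp (by fun_prop)))
    obtain ⟨d, hd⟩ := mem_range_of_exists_le_of_exists_ge (c := 0) hc
      ⟨0, by nlinarith [pl_pos (x + 0)]⟩ ⟨χ, by nlinarith [pl_le_one (x + χ)]⟩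
    exact ⟨d, fun _ => by simp only at hd; linarith⟩
  · exact ⟨0, fun h' => absurd h' h⟩

/-- The displacement of the proximal map, solving `d = χ p(x+d)`. -/
def dP (χ x : ℝ) : ℝ := Classical.choose (exists_dP χ x)

lemma dP_eq {χ : ℝ} (h : 0 ≤ χ) (x : ℝ) : dP χ x = χ * pl (x + dP χ x) :=
  Classical.choose_spec (exists_dP χ x) h

lemma dP_nonneg {χ : ℝ} (h : 0 ≤ χ) (x : ℝ) : 0 ≤ dP χ x := by
  rw [dP_eq h]; exact mul_nonneg h (pl_pos _).le

lemma dP_le {χ : ℝ} (h : 0 ≤ χ) (x : ℝ) : dP χ x ≤ χ := by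
  rw [dP_eq h]; nlinarith [pl_le_one (x + dP χ x)]

lemma dP_mono_x {χ : ℝ} (h : 0 ≤ χ) {x y : ℝ} (hxy : x ≤ y) :
    dP χ y ≤ dP χ x ∧ dP χ x ≤ dP χ y + (y - x) := by
  have h1 := dP_eq h x
  have h2 := dP_eq h y
  have hu : x + dP χ x ≤ y + dP χ y := by
    by_contra hlt
    push Not at hlt
    have := mul_le_mul_of_nonneg_left (pl_anti hlt.le) h
    linarith
  have := mul_le_mul_of_nonneg_left (pl_anti hu) h
  constructor <;> linarith

lemma dP_mono_chi {a b : ℝ} (ha : 0 ≤ a) (hab : a ≤ b) (x : ℝ) :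
    dP a x ≤ dP b x ∧ dP b x ≤ dP a x + (b - a) := by
  have hb := ha.trans hab
  have h1 := dP_eq ha x
  have h2 := dP_eq hb x
  have hu : dP a x ≤ dP b x := by
    by_contra hlt
    push Not at hlt
    have h3 : pl (x + dP a x) ≤ pl (x + dP b x) := pl_anti (by linarith)
    have := mul_le_mul hab h3 (pl_pos _).le hb
    linarith
  refine ⟨hu, ?_⟩
  have h3 : pl (x + dP b x) ≤ pl (x + dP a x) := pl_anti (by linarith)
  nlinarith [pl_le_one (x + dP b x)]

lemma dP_continuous {χ : ℝ} (h : 0 ≤ χ) : Continuous (dP χ) := by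
  refine (LipschitzWith.of_le_add fun x y => ?_).continuous
  rw [Real.dist_eq]
  rcases le_total x y with hxy | hxy
  · have := (dP_mono_x h hxy).2
    rw [abs_sub_comm]
    linarith [le_abs_self (y - x)]
  · have := (dP_mono_x h hxy).1
    linarith [abs_nonneg (x - y)]

lemma dP_continuousOn_chi (x : ℝ) : ContinuousOn (fun χ => dP χ x) (Set.Ici 0) := by
  refine (LipschitzOnWith.of_le_add fun a ha b hb => ?_).continuousOn
  rw [Real.dist_eq]
  rcases le_total a b with hab | hab
  · have := (dP_mono_chi ha hab x).1
    linarith [abs_nonneg (a - b)]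
  · have := (dP_mono_chi hb hab x).2
    linarith [le_abs_self (a - b)]

/-- Explicit value of the pointwise Moreau envelope. -/
lemma env_min {χ : ℝ} (h : 0 < χ) (x u : ℝ) :
    dP χ x ^ 2 / (2 * χ) + logisticLoss (x + dP χ x) ≤ (u - x) ^ 2 / (2 * χ) + logisticLoss u := by
  have h1 := ell_tangent (x + dP χ x) u
  set d := dP χ x with hd
  have h2 : d = χ * pl (x + d) := dP_eq h.le x
  set p := pl (x + d)
  have h3 : d ^ 2 / (2 * χ) + p * (u - (x + d)) ≤ (u - x) ^ 2 / (2 * χ) := by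
    rw [← sub_nonneg]
    have : (u - x) ^ 2 / (2 * χ) - (d ^ 2 / (2 * χ) + p * (u - (x + d))) =
        (u - (x + d)) ^ 2 / (2 * χ) + (d / χ - p) * (u - (x + d)) := by
      field_simp
      ring
    rw [this, h2]
    have h5 : χ * p / χ - p = 0 := by field_simp; ring
    rw [h5, zero_mul, add_zero]
    positivity
  linarith

lemma env_bdd {χ : ℝ} (h : 0 < χ) (y c : ℝ) :
    BddBelow (Set.range fun s : ℝ => (s - y) ^ 2 / (2 * χ) + logisticLoss (s - c)) :=
  ⟨0, by rintro _ ⟨s, rfl⟩; have := ell_pos (s - c); positivity⟩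

lemma env_eq {χ : ℝ} (h : 0 < χ) (y c : ℝ) :
    (⨅ s : ℝ, ((s - y) ^ 2 / (2 * χ) + logisticLoss (s - c))) =
      dP χ (y - c) ^ 2 / (2 * χ) + logisticLoss (y - c + dP χ (y - c)) := by
  refine le_antisymm ?_ ?_
  · refine (ciInf_le (env_bdd h y c) (y + dP χ (y - c))).trans (le_of_eq ?_)
    congr 2 <;> ring
  · refine le_ciInf fun s => ?_
    have := env_min h (y - c) (s - c)
    rwa [show s - c - (y - c) = s - y by ring] at this

lemma integrable_ell_affine {w : ℝ → ℝ} (hw : Continuous w) (A B : ℝ)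
    (hb : ∀ g, |w g| ≤ A + B * |g|) (hB : 0 ≤ B) :
    Integrable (fun g => logisticLoss (w g)) gam := by
  refine integ_of_bound (ell_continuous.comp hw) (A + B + 1) B fun g => ?_
  have h1 := ell_abs_le (w g)
  have h2 := hb g
  nlinarith [abs_le_one_add_sq g]

lemma integrable_dP_sq {χ : ℝ} (h : 0 ≤ χ) (ν c : ℝ) :
    Integrable (fun g => dP χ (ν * g - c) ^ 2) gam := by
  refine integ_of_bound (((dP_continuous h).comp (by fun_prop)).pow 2) (χ ^ 2) 0 fun g => ?_
  rw [abs_of_nonneg (sq_nonneg _), zero_mul, add_zero]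
  exact pow_le_pow_left₀ (dP_nonneg h _) (dP_le h _) 2

lemma prox_bound {χ : ℝ} (h : 0 ≤ χ) (ν c g : ℝ) :
    |ν * g - c + dP χ (ν * g - c)| ≤ (|c| + χ) + |ν| * |g| := by
  have h1 := abs_add_le (ν * g - c) (dP χ (ν * g - c))
  have h2 := abs_sub (ν * g) c
  rw [abs_mul] at h2
  have h3 : |dP χ (ν * g - c)| ≤ χ := by rw [abs_of_nonneg (dP_nonneg h _)]; exact dP_le h _
  linarith

lemma prox_continuous {χ : ℝ} (h : 0 ≤ χ) (ν c : ℝ) :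
    Continuous fun g => ν * g - c + dP χ (ν * g - c) :=
  Continuous.add (by fun_prop) ((dP_continuous h).comp (by fun_prop))

lemma integrable_ell_prox {χ : ℝ} (h : 0 ≤ χ) (ν c : ℝ) :
    Integrable (fun g => logisticLoss (ν * g - c + dP χ (ν * g - c))) gam :=
  integrable_ell_affine (prox_continuous h ν c) _ _ (prox_bound h ν c) (abs_nonneg ν)

lemma moreau_eq (r β ν : ℝ) {χ : ℝ} (h : 0 < χ) : scalarMoreau r β ν χ =
    (∫ g, dP χ (ν * g - scalarTAM r β ν) ^ 2 ∂gam) / (2 * χ) +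
    ∫ g, logisticLoss (ν * g - scalarTAM r β ν + dP χ (ν * g - scalarTAM r β ν)) ∂gam := by
  unfold scalarMoreau
  simp_rw [env_eq h]
  rw [integral_add ((integrable_dP_sq h.le _ _).div_const _) (integrable_ell_prox h.le _ _),
    integral_div]

lemma moreau_le (r β ν : ℝ) {χ : ℝ} (h : 0 < χ) {u : ℝ → ℝ}
    (h1 : Integrable (fun g => (u g - (ν * g - scalarTAM r β ν)) ^ 2) gam)
    (h2 : Integrable (fun g => logisticLoss (u g)) gam) :
    scalarMoreau r β ν χ ≤ (∫ g, (u g - (ν * g - scalarTAM r β ν)) ^ 2 ∂gam) / (2 * χ) +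
      ∫ g, logisticLoss (u g) ∂gam := by
  rw [moreau_eq r β ν h, ← integral_div, ← integral_div,
    ← integral_add ((integrable_dP_sq h.le _ _).div_const _) (integrable_ell_prox h.le _ _),
    ← integral_add (h1.div_const _) h2]
  refine integral_mono (((integrable_dP_sq h.le _ _).div_const _).add
    (integrable_ell_prox h.le _ _)) ((h1.div_const _).add h2) fun g => ?_
  exact env_min h _ _

lemma moreau_ge (r β ν : ℝ) {χ : ℝ} (h : 0 < χ) {f : ℝ → ℝ} (hf : Integrable f gam)
    (hb : ∀ g u, f g ≤ (u - (ν * g - scalarTAM r β ν)) ^ 2 / (2 * χ) + logisticLoss u) :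
    ∫ g, f g ∂gam ≤ scalarMoreau r β ν χ := by
  rw [moreau_eq r β ν h, ← integral_div,
    ← integral_add ((integrable_dP_sq h.le _ _).div_const _) (integrable_ell_prox h.le _ _)]
  refine integral_mono hf (((integrable_dP_sq h.le _ _).div_const _).add
    (integrable_ell_prox h.le _ _)) fun g => ?_
  have := hb g (ν * g - scalarTAM r β ν + dP χ (ν * g - scalarTAM r β ν))
  rwa [add_sub_cancel_left] at this

/-- Weak duality for the saddle potential. -/
lemma saddle_le {α : ℝ} (_hα : 0 < α) (r β lam ν : ℝ) {χ : ℝ} (h : 0 < χ) {u : ℝ → ℝ}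
    (h1 : Integrable (fun g => (u g - (ν * g - scalarTAM r β ν)) ^ 2) gam)
    (h2 : Integrable (fun g => logisticLoss (u g)) gam)
    (h3 : ∫ g, (u g - (ν * g - scalarTAM r β ν)) ^ 2 ∂gam ≤ ν ^ 2 / α) :
    saddlePotential α r β lam ν χ ≤ lam / 2 * ν ^ 2 + ∫ g, logisticLoss (u g) ∂gam := by
  have hm := moreau_le r β ν h h1 h2
  have h4 := div_le_div_of_nonneg_right h3 (by positivity : 0 ≤ 2 * χ)
  have h5 : ν ^ 2 / α / (2 * χ) = ν ^ 2 / (2 * α * χ) := by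
    rw [div_div]; congr 1; ring
  unfold saddlePotential
  linarith

lemma reduced_le {α : ℝ} (hα : 0 < α) (r β lam ν : ℝ) {u : ℝ → ℝ}
    (h1 : Integrable (fun g => (u g - (ν * g - scalarTAM r β ν)) ^ 2) gam)
    (h2 : Integrable (fun g => logisticLoss (u g)) gam)
    (h3 : ∫ g, (u g - (ν * g - scalarTAM r β ν)) ^ 2 ∂gam ≤ ν ^ 2 / α) :
    reducedPotential α r β lam ν ≤ lam / 2 * ν ^ 2 + ∫ g, logisticLoss (u g) ∂gam := by
  have : Nonempty {x : ℝ // 0 < x} := ⟨⟨1, one_pos⟩⟩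
  exact ciSup_le fun χ => saddle_le hα r β lam ν χ.2 h1 h2 h3

/-- Existence of the optimal `χ`. -/
lemma exists_chi {r β α : ℝ} (hr0 : 0 < r) (hr1 : r < 1) (hβ : 0 < β) (hα : 0 < α)
    {ν : ℝ} (hν : 0 < ν) :
    ∃ χ, 0 < χ ∧ ∫ g, dP χ (ν * g - scalarTAM r β ν) ^ 2 ∂gam = ν ^ 2 / α := by
  set c := scalarTAM r β ν with hc
  have hc0 : 0 ≤ c := tam_nonneg hr0 hr1 hβ hν
  set m := gam.real (Set.Iic 0) with hm
  have hm0 : 0 < m := by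
    have : 0 < gam (Set.Iio (0 : ℝ)) := isOpen_Iio.measure_pos _ ⟨-1, by simp⟩
    have h2 : 0 < gam (Set.Iic (0 : ℝ)) := this.trans_le (measure_mono Set.Iio_subset_Iic_self)
    exact ENNReal.toReal_pos h2.ne' (measure_ne_top _ _)
  have htgt : 0 < ν ^ 2 / α := by positivity
  set R := Real.sqrt (ν ^ 2 / α / m) with hR
  have hR0 : 0 < R := Real.sqrt_pos.2 (by positivity)
  have hR2 : R ^ 2 * m = ν ^ 2 / α := by
    rw [hR, Real.sq_sqrt (by positivity), div_mul_cancel₀ _ hm0.ne']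
  set X := R / pl R with hX
  have hX0 : 0 < X := div_pos hR0 (pl_pos _)
  have hlow : ∀ x ≤ 0, R ≤ dP X x := by
    intro x hx
    by_contra hlt
    push Not at hlt
    have h1 : pl R ≤ pl (x + dP X x) := pl_anti (by linarith)
    have h2 := dP_eq hX0.le x
    have h3 := mul_le_mul_of_nonneg_left h1 hX0.le
    have h4 : X * pl R = R := div_mul_cancel₀ _ (pl_pos R).ne'
    linarith
  have hcont : ContinuousOn (fun χ => ∫ g, dP χ (ν * g - c) ^ 2 ∂gam) (Set.Icc 0 X) := by
    refine continuousOn_of_dominated (bound := fun _ => X ^ 2) ?_ ?_ (integrable_const _) ?_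
    · intro χ hχ
      exact (((dP_continuous hχ.1).comp (by fun_prop)).pow 2).aestronglyMeasurable
    · intro χ hχ
      refine ae_of_all _ fun g => ?_
      rw [Real.norm_eq_abs, abs_of_nonneg (sq_nonneg _)]
      exact pow_le_pow_left₀ (dP_nonneg hχ.1 _) ((dP_le hχ.1 _).trans hχ.2) 2
    · refine ae_of_all _ fun g => ?_
      exact ((dP_continuousOn_chi _).mono Set.Icc_subset_Ici_self).pow 2
  have h0 : ∫ g, dP 0 (ν * g - c) ^ 2 ∂gam = 0 := by
    have : ∀ g, dP 0 (ν * g - c) = 0 := fun g => by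
      rw [dP_eq le_rfl]; simp
    simp [this]
  have h1 : ν ^ 2 / α ≤ ∫ g, dP X (ν * g - c) ^ 2 ∂gam := by
    rw [← hR2]
    have : ∫ g, (Set.Iic (0 : ℝ)).indicator (fun _ => R ^ 2) g ∂gam ≤
        ∫ g, dP X (ν * g - c) ^ 2 ∂gam := by
      refine integral_mono ((integrable_const _).indicator measurableSet_Iic)
        (integrable_dP_sq hX0.le _ _) fun g => ?_
      refine Set.indicator_apply_le' (fun hg => ?_) (fun _ => sq_nonneg _)
      have hg' : g ≤ 0 := hg
      exact pow_le_pow_left₀ hR0.le (hlow _ (by nlinarith)) 2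
    rw [integral_indicator_const _ measurableSet_Iic, smul_eq_mul] at this
    linarith
  obtain ⟨χ, hχ, he⟩ := intermediate_value_Icc hX0.le hcont ⟨by rw [h0]; exact htgt.le, h1⟩
  refine ⟨χ, lt_of_le_of_ne hχ.1 ?_, he⟩
  rintro rfl
  simp only at he
  rw [h0] at he
  linarith

/-- Strong duality for the reduced potential. -/
lemma reduced_eq {r β α : ℝ} (hr0 : 0 < r) (hr1 : r < 1) (hβ : 0 < β) (hα : 0 < α)
    {ν : ℝ} (hν : 0 < ν) :
    ∃ χ, 0 < χ ∧ ∫ g, dP χ (ν * g - scalarTAM r β ν) ^ 2 ∂gam = ν ^ 2 / α ∧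
      ∀ lam, reducedPotential α r β lam ν = lam / 2 * ν ^ 2 +
        ∫ g, logisticLoss (ν * g - scalarTAM r β ν + dP χ (ν * g - scalarTAM r β ν)) ∂gam := by
  obtain ⟨χ, hχ, he⟩ := exists_chi hr0 hr1 hβ hα hν
  refine ⟨χ, hχ, he, fun lam => ?_⟩
  have e1 : ∀ g, (ν * g - scalarTAM r β ν + dP χ (ν * g - scalarTAM r β ν) -
      (ν * g - scalarTAM r β ν)) ^ 2 = dP χ (ν * g - scalarTAM r β ν) ^ 2 := fun g => by ring
  have hle : ∀ χ' : {x : ℝ // 0 < x}, saddlePotential α r β lam ν χ' ≤ lam / 2 * ν ^ 2 +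
      ∫ g, logisticLoss (ν * g - scalarTAM r β ν + dP χ (ν * g - scalarTAM r β ν)) ∂gam := by
    intro χ'
    refine saddle_le hα r β lam ν χ'.2 (u := fun g => ν * g - scalarTAM r β ν +
      dP χ (ν * g - scalarTAM r β ν)) ?_ (integrable_ell_prox hχ.le _ _) ?_
    · simp_rw [e1]; exact integrable_dP_sq hχ.le _ _
    · simp_rw [e1]; exact he.le
  have : Nonempty {x : ℝ // 0 < x} := ⟨⟨1, one_pos⟩⟩
  refine le_antisymm (ciSup_le hle) ?_
  refine le_trans (le_of_eq ?_) (le_ciSup (f := fun χ' : {x : ℝ // 0 < x} =>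
    saddlePotential α r β lam ν χ') ⟨_, by rintro _ ⟨χ', rfl⟩; exact hle χ'⟩ ⟨χ, hχ⟩)
  simp only [saddlePotential]
  rw [moreau_eq r β ν hχ, he]
  have h5 : ν ^ 2 / α / (2 * χ) = ν ^ 2 / (2 * α * χ) := by
    rw [div_div]; congr 1; ring
  rw [h5]; ring

lemma saddle_le_reduced {r β α : ℝ} (hr0 : 0 < r) (hr1 : r < 1) (hβ : 0 < β) (hα : 0 < α)
    {ν : ℝ} (hν : 0 < ν) (lam : ℝ) {χ : ℝ} (hχ : 0 < χ) :
    saddlePotential α r β lam ν χ ≤ reducedPotential α r β lam ν := by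
  obtain ⟨χ', hχ', he, hV⟩ := reduced_eq hr0 hr1 hβ hα hν
  have e1 : ∀ g, (ν * g - scalarTAM r β ν + dP χ' (ν * g - scalarTAM r β ν) -
      (ν * g - scalarTAM r β ν)) ^ 2 = dP χ' (ν * g - scalarTAM r β ν) ^ 2 := fun g => by ring
  rw [hV]
  refine saddle_le hα r β lam ν hχ (u := fun g => ν * g - scalarTAM r β ν +
      dP χ' (ν * g - scalarTAM r β ν)) ?_ (integrable_ell_prox hχ'.le _ _) ?_
  · simp_rw [e1]; exact integrable_dP_sq hχ'.le _ _
  · simp_rw [e1]; exact he.le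

lemma reduced_lam {r β α : ℝ} (hr0 : 0 < r) (hr1 : r < 1) (hβ : 0 < β) (hα : 0 < α)
    {ν : ℝ} (hν : 0 < ν) (lam : ℝ) :
    reducedPotential α r β lam ν = lam / 2 * ν ^ 2 + reducedPotential α r β 0 ν := by
  obtain ⟨χ', hχ', he, hV⟩ := reduced_eq hr0 hr1 hβ hα hν
  rw [hV lam, hV 0]; ring

/-! ### Bounds on the reduced potential -/

lemma quad_bound {χ : ℝ} (h : 0 < χ) (p v : ℝ) : p * v - χ * p ^ 2 / 2 ≤ v ^ 2 / (2 * χ) := by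
  have : v ^ 2 / (2 * χ) - (p * v - χ * p ^ 2 / 2) = (v - χ * p) ^ 2 / (2 * χ) := by
    field_simp; ring
  have h2 : 0 ≤ (v - χ * p) ^ 2 / (2 * χ) := by positivity
  linarith

lemma reduced_lower {r β α : ℝ} (hr0 : 0 < r) (hr1 : r < 1) (hβ : 0 < β) (hα : 0 < α)
    {ν : ℝ} (hν : 0 < ν) : logisticLoss (ν / Real.sqrt α) ≤ reducedPotential α r β 0 ν := by
  set c := scalarTAM r β ν with hc
  have hc0 : 0 ≤ c := tam_nonneg hr0 hr1 hβ hν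
  set a := ν / Real.sqrt α with ha
  have ha0 : 0 < a := div_pos hν (Real.sqrt_pos.2 hα)
  have ha2 : a ^ 2 = ν ^ 2 / α := by rw [ha, div_pow, Real.sq_sqrt hα.le]
  set p := pl (a - c) with hp
  have hp0 : 0 < p := pl_pos _
  have hχ : 0 < a / p := div_pos ha0 hp0
  refine le_trans ?_ (saddle_le_reduced hr0 hr1 hβ hα hν 0 hχ)
  have hi : Integrable (fun g => logisticLoss (a - c) + p * a - a / p * p ^ 2 / 2 - p * ν * g) gam :=
    (integrable_const _).sub (integrable_id_gam.const_mul _)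
  have hm := moreau_ge r β ν hχ hi (fun g u => by
    have h1 := ell_tangent (a - c) u
    have h2 := quad_bound hχ p (u - (ν * g - c))
    rw [← hp] at h1
    rw [← hc]
    linarith)
  rw [integral_sub (integrable_const _) (integrable_id_gam.const_mul _), integral_const_mul,
    integral_id_gam] at hm
  simp only [integral_const, probReal_univ, one_smul] at hm
  have h3 : a / p * p ^ 2 / 2 = a * p / 2 := by field_simp
  have h4 : ν ^ 2 / (2 * α * (a / p)) = a * p / 2 := by
    rw [show ν ^ 2 / (2 * α * (a / p)) = (ν ^ 2 / α) / (2 * (a / p)) by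
        rw [mul_comm 2 α, mul_assoc, ← div_div],
      ← ha2]
    field_simp
  have h5 : logisticLoss a ≤ logisticLoss (a - c) := ell_anti (by linarith)
  unfold saddlePotential
  rw [h4]
  linarith

/-- The squared positive-part moment `E[(k-G)_+^2]` in closed form. -/
def Psi (k : ℝ) : ℝ := (1 + k ^ 2) * Phi k + k * normPDF k

lemma Psi_continuous : Continuous Psi := by
  have h1 : Continuous normPDF :=
    continuous_iff_continuousAt.2 fun x => (normPDF_hasDerivAt x).continuousAt
  have h2 := continuous_Phi
  unfold Psi
  fun_prop

lemma Psi_pos {r : ℝ} (hr0 : 0 < r) : 0 < Psi (kappaR r) := by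
  have h1 := mul_pos (kappa_pos hr0) (normPDF_pos (kappaR r))
  have h2 : 0 ≤ Phi (kappaR r) := ENNReal.toReal_nonneg
  unfold Psi
  positivity

lemma reduced_coercive {r β α : ℝ} (hr0 : 0 < r) (hr1 : r < 1) (hβ : 0 < β) (hα : 0 < α)
    (h : 1 / α < Psi (kappaR r)) :
    ∃ δ, 0 < δ ∧ ∀ ν, 0 < ν → δ * ν ≤ reducedPotential α r β 0 ν := by
  set κ := kappaR r with hκ
  have hlim : Tendsto (fun n : ℕ => ∫ g, (min (max (κ - g) 0) (n : ℝ)) ^ 2 ∂gam) atTop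
      (𝓝 (∫ g, (max (κ - g) 0) ^ 2 ∂gam)) := by
    refine tendsto_integral_of_dominated_convergence (fun g => (max (κ - g) 0) ^ 2) ?_ ?_ ?_ ?_
    · intro n
      exact (Continuous.aestronglyMeasurable (by fun_prop))
    · refine integ_of_bound (by fun_prop) (2 * κ ^ 2) 2 fun g => ?_
      rw [abs_of_nonneg (sq_nonneg _)]
      rcases le_total (κ - g) 0 with h1 | h1
      · rw [max_eq_right h1]; nlinarith [sq_nonneg κ, sq_nonneg g]
      · rw [max_eq_left h1]; nlinarith [sq_nonneg (κ + g)]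
    · intro n
      refine ae_of_all _ fun g => ?_
      rw [Real.norm_eq_abs, abs_of_nonneg (sq_nonneg _)]
      exact pow_le_pow_left₀ (le_min (le_max_right _ _) (Nat.cast_nonneg n)) (min_le_left _ _) 2
    · refine ae_of_all _ fun g => ?_
      refine tendsto_const_nhds.congr' ?_
      obtain ⟨N, hN⟩ := exists_nat_ge (max (κ - g) 0)
      filter_upwards [eventually_ge_atTop N] with n hn
      have : (N : ℝ) ≤ n := by exact_mod_cast hn
      rw [min_eq_left (by linarith)]
  rw [integral_pos_sq] at hlim
  obtain ⟨n, hn, hn1⟩ := ((hlim.eventually (lt_mem_nhds h)).and (eventually_ge_atTop 1)).exists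
  set b : ℝ := (n : ℝ) with hb
  have hb0 : 0 < b := by rw [hb]; exact_mod_cast hn1
  set I := ∫ g, (min (max (κ - g) 0) b) ^ 2 ∂gam with hI
  refine ⟨(I - 1 / α) / (2 * b), div_pos (by linarith) (by positivity), fun ν hν => ?_⟩
  have hχ : 0 < b * ν := mul_pos hb0 hν
  refine le_trans ?_ (saddle_le_reduced hr0 hr1 hβ hα hν 0 hχ)
  have hi : Integrable (fun g => ν / (2 * b) * (min (max (κ - g) 0) b) ^ 2) gam := by
    refine Integrable.const_mul (integ_of_bound (by fun_prop) (b ^ 2) 0 fun g => ?_) _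
    rw [abs_of_nonneg (sq_nonneg _), zero_mul, add_zero]
    exact pow_le_pow_left₀ (le_min (le_max_right _ _) hb0.le) (min_le_right _ _) 2
  have hm := moreau_ge r β ν hχ hi (fun g u => by
    set c := scalarTAM r β ν
    have hck : κ * ν ≤ c := tam_ge hr0 hr1 hβ ν
    set S := min (max (κ - g) 0) b with hS
    have hS0 : 0 ≤ S := le_min (le_max_right _ _) hb0.le
    have hSb : S ≤ b := min_le_right _ _
    set T := S / b with hT
    have hT0 : 0 ≤ T := by positivity
    have hT1 : T ≤ 1 := by rw [hT, div_le_one hb0]; exact hSb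
    have hST : S = T * b := by rw [hT]; field_simp
    have h1 : -(T * u) ≤ logisticLoss u := by
      have e1 := ell_ge u
      have e2 := (ell_pos u).le
      nlinarith
    have h2 := quad_bound hχ T (u - (ν * g - c))
    have h3 : T * (T * b) ≤ T * (κ - g) := by
      rcases le_total (κ - g) 0 with h | h
      · have : S = 0 := by rw [hS, max_eq_right h, min_eq_left hb0.le]
        have hT' : T = 0 := by rw [hT, this, zero_div]
        rw [hT']; simp
      · have : S ≤ κ - g := (min_le_left _ _).trans (by rw [max_eq_left h])
        rw [← hST]
        exact mul_le_mul_of_nonneg_left this hT0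
    have h4 : ν / (2 * b) * S ^ 2 = ν * b * T ^ 2 / 2 := by rw [hST]; field_simp
    rw [h4]
    have h5 := mul_le_mul_of_nonneg_left hck hT0
    have h6 := mul_le_mul_of_nonneg_left h3 hν.le
    nlinarith)
  rw [integral_const_mul, ← hI] at hm
  unfold saddlePotential
  have h7 : ν ^ 2 / (2 * α * (b * ν)) = ν / (2 * b) * (1 / α) := by field_simp
  have h8 : (I - 1 / α) / (2 * b) * ν = ν / (2 * b) * I - ν / (2 * b) * (1 / α) := by field_simp
  rw [h7, h8]
  linarith

lemma reduced_upper {r β α : ℝ} (hr0 : 0 < r) (hr1 : r < 1) (hβ : 0 < β) (hα : 0 < α)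
    (h : Psi (kappaR r) < 1 / α) (k : ℝ) :
    ∃ ν, 0 < ν ∧ reducedPotential α r β 0 ν ≤ logisticLoss k := by
  set κ := kappaR r with hκ
  set C := (1 / r) * (Real.log 2 / β) with hC
  have hlim : Tendsto (fun ν : ℝ => Psi (κ + (k + C) / ν)) atTop (𝓝 (Psi κ)) := by
    have h1 : Tendsto (fun ν : ℝ => κ + (k + C) / ν) atTop (𝓝 κ) := by
      have := (tendsto_const_nhds (x := k + C)).div_atTop (tendsto_id (α := ℝ) (x := atTop))
      simpa using this.const_add κ
    exact (Psi_continuous.tendsto κ).comp h1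
  obtain ⟨ν, hν1, hν⟩ := ((hlim.eventually (gt_mem_nhds h)).and (eventually_gt_atTop 0)).exists
  refine ⟨ν, hν, ?_⟩
  set c := scalarTAM r β ν with hc
  have hcle : c ≤ κ * ν + C := tam_le hr0 hr1 hβ hν
  have hbd : ∀ g, (max (ν * g - c) k - (ν * g - c)) ^ 2 ≤
      ν ^ 2 * (max (κ + (k + C) / ν - g) 0) ^ 2 := by
    intro g
    rw [← mul_pow]
    refine pow_le_pow_left₀ (by linarith [le_max_left (ν * g - c) k]) ?_ 2
    rw [sub_le_iff_le_add]
    have e1 : ν * (κ + (k + C) / ν - g) = κ * ν + k + C - ν * g := by field_simp; ring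
    have e2 := mul_le_mul_of_nonneg_left (le_max_left (κ + (k + C) / ν - g) 0) hν.le
    have e3 := mul_le_mul_of_nonneg_left (le_max_right (κ + (k + C) / ν - g) 0) hν.le
    refine max_le ?_ ?_ <;> linarith
  have hintg : ∀ K : ℝ, Integrable (fun g => (max (K - g) 0) ^ 2) gam := fun K => by
    refine integ_of_bound (by fun_prop) (2 * K ^ 2) 2 fun g => ?_
    rw [abs_of_nonneg (sq_nonneg _)]
    rcases le_total (K - g) 0 with h1 | h1
    · rw [max_eq_right h1]; nlinarith [sq_nonneg K, sq_nonneg g]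
    · rw [max_eq_left h1]; nlinarith [sq_nonneg (K + g)]
  have hi1 : Integrable (fun g => (max (ν * g - c) k - (ν * g - c)) ^ 2) gam := by
    refine ((hintg (κ + (k + C) / ν)).const_mul (ν ^ 2)).mono'
      (Continuous.aestronglyMeasurable (by fun_prop)) (ae_of_all _ fun g => ?_)
    rw [Real.norm_eq_abs, abs_of_nonneg (sq_nonneg _)]
    exact hbd g
  have hi2 : Integrable (fun g => logisticLoss (max (ν * g - c) k)) gam := by
    refine (integrable_const (logisticLoss k)).mono'
      (ell_continuous.comp (by fun_prop)).aestronglyMeasurable (ae_of_all _ fun g => ?_)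
    rw [Real.norm_eq_abs, abs_of_pos (ell_pos _)]
    exact ell_anti (le_max_right _ _)
  have hle := reduced_le hα r β 0 ν hi1 hi2 (by
    refine (integral_mono hi1 ((hintg (κ + (k + C) / ν)).const_mul (ν ^ 2)) hbd).trans ?_
    rw [integral_const_mul, integral_pos_sq]
    have := mul_le_mul_of_nonneg_left hν1.le (sq_nonneg ν)
    rw [mul_one_div] at this
    exact this)
  refine hle.trans ?_
  have : ∫ g, logisticLoss (max (ν * g - c) k) ∂gam ≤ ∫ g, logisticLoss k ∂gam :=
    integral_mono hi2 (integrable_const _) fun g => ell_anti (le_max_right _ _)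
  simp only [integral_const, probReal_univ, one_smul] at this
  linarith

/-- Strict convexity of the ridgeless reduced potential. -/
lemma reduced_strictConvex {r β α : ℝ} (hr0 : 0 < r) (hr1 : r < 1) (hβ : 0 < β) (hα : 0 < α) :
    StrictConvexOn ℝ (Set.Ioi 0) (reducedPotential α r β 0) := by
  refine ⟨convex_Ioi 0, ?_⟩
  intro a ha b hb hab t s ht hs hts
  simp only [smul_eq_mul]
  have ha' : 0 < a := ha
  have hb' : 0 < b := hb
  obtain ⟨χa, hχa, hea, hVa⟩ := reduced_eq hr0 hr1 hβ hα ha'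
  obtain ⟨χb, hχb, heb, hVb⟩ := reduced_eq hr0 hr1 hβ hα hb'
  have hcc := tam_convex hr0 hr1 hβ a b ht hs hts
  set ν := t * a + s * b with hν
  have hν0 : 0 < ν := by positivity
  rw [hVa 0, hVb 0]
  set ca := scalarTAM r β a
  set cb := scalarTAM r β b
  set c := scalarTAM r β ν with hc
  set da : ℝ → ℝ := fun g => dP χa (a * g - ca) with hda
  set db : ℝ → ℝ := fun g => dP χb (b * g - cb) with hdb
  set ua : ℝ → ℝ := fun g => a * g - ca + da g with hua
  set ub : ℝ → ℝ := fun g => b * g - cb + db g with hub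
  have hda0 : ∀ g, 0 ≤ da g := fun g => dP_nonneg hχa.le _
  have hdb0 : ∀ g, 0 ≤ db g := fun g => dP_nonneg hχb.le _
  have hua_c : Continuous ua := prox_continuous hχa.le a ca
  have hub_c : Continuous ub := prox_continuous hχb.le b cb
  have hia : Integrable (fun g => logisticLoss (ua g)) gam := integrable_ell_prox hχa.le a ca
  have hib : Integrable (fun g => logisticLoss (ub g)) gam := integrable_ell_prox hχb.le b cb
  have hja : Integrable (fun g => da g ^ 2) gam := integrable_dP_sq hχa.le a ca
  have hjb : Integrable (fun g => db g ^ 2) gam := integrable_dP_sq hχb.le b cb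
  set w : ℝ → ℝ := fun g => t * ua g + s * ub g with hw
  have hw_c : Continuous w := (continuous_const.mul hua_c).add (continuous_const.mul hub_c)
  have hwx : ∀ g, w g - (ν * g - c) ≤ t * da g + s * db g := by
    intro g
    simp only [hw, hua, hub, hν]
    linarith
  have hbd : ∀ g, (max (w g) (ν * g - c) - (ν * g - c)) ^ 2 ≤
      t * ν / a * da g ^ 2 + s * ν / b * db g ^ 2 := by
    intro g
    have h1 : (max (w g) (ν * g - c) - (ν * g - c)) ^ 2 ≤ (t * da g + s * db g) ^ 2 := by
      refine pow_le_pow_left₀ (by linarith [le_max_right (w g) (ν * g - c)]) ?_ 2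
      rw [sub_le_iff_le_add]
      have e0 : 0 ≤ t * da g + s * db g :=
        add_nonneg (mul_nonneg ht.le (hda0 g)) (mul_nonneg hs.le (hdb0 g))
      refine max_le ?_ ?_
      · linarith [hwx g]
      · linarith
    refine h1.trans ?_
    have h2 : t * ν / a * da g ^ 2 + s * ν / b * db g ^ 2 - (t * da g + s * db g) ^ 2 =
        t * s / (a * b) * (b * da g - a * db g) ^ 2 := by
      rw [hν]; field_simp; ring
    have h3 : 0 ≤ t * s / (a * b) * (b * da g - a * db g) ^ 2 := by positivity
    linarith
  have hj : Integrable (fun g => t * ν / a * da g ^ 2 + s * ν / b * db g ^ 2) gam :=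
    (hja.const_mul _).add (hjb.const_mul _)
  have hiw : Integrable (fun g => logisticLoss (w g)) gam := by
    refine ((hia.const_mul t).add (hib.const_mul s)).mono'
      (ell_continuous.comp hw_c).aestronglyMeasurable (ae_of_all _ fun g => ?_)
    rw [Real.norm_eq_abs, abs_of_pos (ell_pos _)]
    exact ell_convex _ _ ht hs hts
  have hxc : Continuous fun g : ℝ => ν * g - c := by fun_prop
  have hi1 : Integrable (fun g => (max (w g) (ν * g - c) - (ν * g - c)) ^ 2) gam := by
    refine hj.mono' ((((hw_c.max hxc).sub hxc).pow 2).aestronglyMeasurable)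
      (ae_of_all _ fun g => ?_)
    rw [Real.norm_eq_abs, abs_of_nonneg (sq_nonneg _)]
    exact hbd g
  have hi2 : Integrable (fun g => logisticLoss (max (w g) (ν * g - c))) gam := by
    refine hiw.mono' (ell_continuous.comp (hw_c.max hxc)).aestronglyMeasurable
      (ae_of_all _ fun g => ?_)
    rw [Real.norm_eq_abs, abs_of_pos (ell_pos _)]
    exact ell_anti (le_max_left _ _)
  have hle := reduced_le hα r β 0 ν hi1 hi2 (by
    refine (integral_mono hi1 hj hbd).trans (le_of_eq ?_)
    rw [integral_add (hja.const_mul _) (hjb.const_mul _), integral_const_mul, integral_const_mul,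
      hea, heb]
    have : t * ν / a * (a ^ 2 / α) + s * ν / b * (b ^ 2 / α) = ν * (t * a + s * b) / α := by
      field_simp
    rw [this, ← hν]; ring)
  have hle2 : ∫ g, logisticLoss (max (w g) (ν * g - c)) ∂gam ≤ ∫ g, logisticLoss (w g) ∂gam :=
    integral_mono hi2 hiw fun g => ell_anti (le_max_left _ _)
  have hstrict : 0 < ∫ g, (t * logisticLoss (ua g) + s * logisticLoss (ub g)
      - logisticLoss (w g)) ∂gam := by
    -- some point where the two proximal functions differ
    obtain ⟨g, hg⟩ : ∃ g, ua g ≠ ub g := by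
      by_contra hall
      push Not at hall
      have hne : a - b ≠ 0 := sub_ne_zero.2 hab
      have e := hall ((ca - cb + χb + 1) / (a - b))
      simp only [hua, hub] at e
      have e1 := hda0 ((ca - cb + χb + 1) / (a - b))
      have e2 : db ((ca - cb + χb + 1) / (a - b)) ≤ χb := dP_le hχb.le _
      have e3 : (a - b) * ((ca - cb + χb + 1) / (a - b)) = ca - cb + χb + 1 :=
        mul_div_cancel₀ _ hne
      linarith
    refine integral_pos_of_integrable_nonneg_nonzero (x := g) ?_
      (((hia.const_mul t).add (hib.const_mul s)).sub hiw) ?_ ?_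
    · exact ((continuous_const.mul (ell_continuous.comp hua_c)).add
        (continuous_const.mul (ell_continuous.comp hub_c))).sub (ell_continuous.comp hw_c)
    · intro g
      have := ell_convex (ua g) (ub g) ht hs hts
      simp only [Pi.zero_apply]
      linarith
    · have := ell_strict hg ht hs hts
      simp only [hw]
      linarith
  have hsum : Integrable (fun g => t * logisticLoss (ua g) + s * logisticLoss (ub g)) gam :=
    (hia.const_mul t).add (hib.const_mul s)
  rw [integral_sub hsum hiw,
    integral_add (hia.const_mul t) (hib.const_mul s), integral_const_mul,
    integral_const_mul] at hstrict
  linarith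

lemma reduced_quasi {r β α : ℝ} (hr0 : 0 < r) (hr1 : r < 1) (hβ : 0 < β) (hα : 0 < α)
    {x y z : ℝ} (hx : 0 < x) (hxz : x < z) (hzy : z < y) :
    reducedPotential α r β 0 z <
      max (reducedPotential α r β 0 x) (reducedPotential α r β 0 y) := by
  refine (reduced_strictConvex hr0 hr1 hβ hα).lt_on_openSegment hx
    (show (0 : ℝ) < y by linarith) (by linarith) ?_
  rw [openSegment_eq_Ioo (by linarith)]
  exact ⟨hxz, hzy⟩


/-- **Ridgeless scalar phase transition.** Fix `r ∈ (0,1)`, `β ∈ (0,∞)`, `α > 0`, and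
for each `λ > 0` let `ν_λ` be the unique positive minimizer of `V_{α,r,λ}`. Then:
(i) if `α < α_c(r)` then `ν_λ → ∞` and `V_{α,r,0}(ν_λ) → 0` as `λ ↓ 0`;
(ii) if `α > α_c(r)` then, as `λ ↓ 0`, `ν_λ` converges to the unique positive
minimizer `ν₀` of the ridgeless potential `V_{α,r,0}`, whose value
`V_{α,r,0}(ν₀)` is strictly positive. -/
theorem ridgeless_phase_transition (r β α : ℝ) (hr0 : 0 < r) (hr1 : r < 1)
    (hβ : 0 < β) (hα : 0 < α) (νfun : ℝ → ℝ)
    (hν : ∀ lam : ℝ, 0 < lam → 0 < νfun lam ∧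
      ∀ ν : ℝ, 0 < ν → reducedPotential α r β lam (νfun lam) ≤
        reducedPotential α r β lam ν) :
    (α < criticalLoad r →
      Tendsto νfun (𝓝[>] 0) atTop ∧
        Tendsto (fun lam => reducedPotential α r β 0 (νfun lam)) (𝓝[>] 0) (𝓝 0)) ∧
    (criticalLoad r < α →
      ∃ ν₀ : ℝ, 0 < ν₀ ∧
        (∀ ν : ℝ, 0 < ν → reducedPotential α r β 0 ν₀ ≤ reducedPotential α r β 0 ν) ∧
        (∀ ν : ℝ, 0 < ν →
          (∀ ν' : ℝ, 0 < ν' →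
            reducedPotential α r β 0 ν ≤ reducedPotential α r β 0 ν') → ν = ν₀) ∧
        Tendsto νfun (𝓝[>] 0) (𝓝 ν₀) ∧
        0 < reducedPotential α r β 0 ν₀) := by
  have hPsi := Psi_pos hr0
  have hcrit : criticalLoad r = 1 / Psi (kappaR r) := rfl
  have hlam : ∀ lam ν : ℝ, 0 < ν →
      reducedPotential α r β lam ν = lam / 2 * ν ^ 2 + reducedPotential α r β 0 ν :=
    fun lam ν hν0 => reduced_lam hr0 hr1 hβ hα hν0 lam
  have hlow : ∀ ν : ℝ, 0 < ν →
      logisticLoss (ν / Real.sqrt α) ≤ reducedPotential α r β 0 ν :=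
    fun ν hν0 => reduced_lower hr0 hr1 hβ hα hν0
  have hpos : ∀ ν : ℝ, 0 < ν → 0 < reducedPotential α r β 0 ν :=
    fun ν hν0 => (ell_pos _).trans_le (hlow ν hν0)
  have hsq : 0 < Real.sqrt α := Real.sqrt_pos.2 hα
  -- an upper bound for the ridgeless value along the regularized minimizers
  have hev : ∀ ν : ℝ, 0 < ν → ∀ M : ℝ, reducedPotential α r β 0 ν < M →
      ∀ᶠ lam in 𝓝[>] (0 : ℝ), reducedPotential α r β 0 (νfun lam) < M := by
    intro ν hν0 M hM
    have ht : Tendsto (fun lam : ℝ => lam / 2 * ν ^ 2 + reducedPotential α r β 0 ν) (𝓝[>] 0)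
        (𝓝 (0 / 2 * ν ^ 2 + reducedPotential α r β 0 ν)) := by
      refine Tendsto.mono_left (Continuous.tendsto ?_ 0) nhdsWithin_le_nhds
      fun_prop
    rw [zero_div, zero_mul, zero_add] at ht
    filter_upwards [ht.eventually (gt_mem_nhds hM), self_mem_nhdsWithin] with lam h1 h2
    have h2' : 0 < lam := h2
    obtain ⟨h3, h4⟩ := hν lam h2'
    have h5 := h4 ν hν0
    rw [hlam lam _ h3, hlam lam _ hν0] at h5
    have h6 : 0 ≤ lam / 2 * νfun lam ^ 2 := by positivity
    linarith
  constructor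
  · intro h
    rw [hcrit, lt_div_iff₀ hPsi, mul_comm, ← lt_div_iff₀ hα] at h
    have hev2 : ∀ ε, 0 < ε → ∀ᶠ lam in 𝓝[>] (0 : ℝ), reducedPotential α r β 0 (νfun lam) < ε := by
      intro ε hε
      obtain ⟨k, hk⟩ := (ell_tendsto.eventually (gt_mem_nhds hε)).exists
      obtain ⟨ν, hν0, hνk⟩ := reduced_upper hr0 hr1 hβ hα h k
      exact hev ν hν0 ε (by linarith)
    constructor
    · rw [tendsto_atTop]
      intro B
      filter_upwards [hev2 _ (ell_pos (B / Real.sqrt α)), self_mem_nhdsWithin] with lam h1 h2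
      by_contra hlt
      push Not at hlt
      have h3 := hlow _ (hν lam h2).1
      have h4 : logisticLoss (B / Real.sqrt α) ≤ logisticLoss (νfun lam / Real.sqrt α) :=
        ell_anti (div_le_div_of_nonneg_right hlt.le hsq.le)
      linarith
    · rw [tendsto_order]
      refine ⟨fun a ha => ?_, fun a ha => hev2 a ha⟩
      filter_upwards [self_mem_nhdsWithin] with lam h2
      exact ha.trans (hpos _ (hν lam h2).1)
  · intro h
    rw [hcrit, div_lt_iff₀ hPsi, mul_comm, ← div_lt_iff₀ hα] at h
    obtain ⟨δ, hδ, hco⟩ := reduced_coercive hr0 hr1 hβ hα h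
    obtain ⟨hn0, hn⟩ := hν 1 one_pos
    set n := νfun 1 with hndef
    have hdec : reducedPotential α r β 0 n < reducedPotential α r β 0 (n / 2) := by
      have h1 := hn (n / 2) (by positivity)
      rw [hlam 1 _ hn0, hlam 1 _ (by positivity)] at h1
      have : 0 < n ^ 2 := by positivity
      nlinarith
    have hcont : ContinuousOn (reducedPotential α r β 0) (Set.Ioi 0) :=
      (reduced_strictConvex hr0 hr1 hβ hα).convexOn.continuousOn isOpen_Ioi
    set R := max n (reducedPotential α r β 0 n / δ) with hR
    have hRn : n ≤ R := le_max_left _ _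
    have hRV : ∀ ν, R ≤ ν → reducedPotential α r β 0 n ≤ reducedPotential α r β 0 ν := by
      intro ν hν1
      have h1 : reducedPotential α r β 0 n / δ ≤ ν := (le_max_right _ _).trans hν1
      rw [div_le_iff₀ hδ] at h1
      have := hco ν (by linarith)
      linarith
    obtain ⟨ν₀, hmem, hmin⟩ := (isCompact_Icc (a := n / 2) (b := R)).exists_isMinOn
      ⟨n, by constructor <;> linarith⟩
      (hcont.mono fun x hx => show (0 : ℝ) < x by have := hx.1; linarith)
    have hν₀ : 0 < ν₀ := by have := hmem.1; linarith
    have hminn : reducedPotential α r β 0 ν₀ ≤ reducedPotential α r β 0 n :=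
      hmin (by constructor <;> linarith)
    have hglob : ∀ ν : ℝ, 0 < ν → reducedPotential α r β 0 ν₀ ≤ reducedPotential α r β 0 ν := by
      intro ν hν0
      by_cases h1 : ν < n / 2
      · have h2 := reduced_quasi hr0 hr1 hβ hα hν0 h1 (by linarith : n / 2 < n)
        rcases lt_max_iff.1 h2 with h3 | h3 <;> linarith
      · by_cases h2 : R ≤ ν
        · exact hminn.trans (hRV ν h2)
        · exact hmin ⟨not_lt.1 h1, (not_le.1 h2).le⟩
    -- strict increase of the value to the left of the minimizer
    have hleft : ∀ x y : ℝ, 0 < x → x < y → y < ν₀ →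
        reducedPotential α r β 0 y < reducedPotential α r β 0 x := by
      intro x y hx hxy hy
      have h1 := reduced_quasi hr0 hr1 hβ hα hx hxy hy
      rcases lt_max_iff.1 h1 with h3 | h3
      · exact h3
      · linarith [hglob y (by linarith)]
    have huniq : ∀ ν : ℝ, 0 < ν → reducedPotential α r β 0 ν ≤ reducedPotential α r β 0 ν₀ →
        ν = ν₀ := by
      intro ν hν0 hle
      by_contra hne
      rcases lt_or_gt_of_ne hne with h1 | h1
      · have h2 := reduced_quasi hr0 hr1 hβ hα hν0 (z := (ν + ν₀) / 2) (by linarith)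
          (by linarith : (ν + ν₀) / 2 < ν₀)
        have h3 := hglob ((ν + ν₀) / 2) (by linarith)
        rw [max_eq_right hle] at h2
        linarith
      · have h2 := reduced_quasi hr0 hr1 hβ hα hν₀ (z := (ν + ν₀) / 2) (by linarith)
          (by linarith : (ν + ν₀) / 2 < ν)
        have h3 := hglob ((ν + ν₀) / 2) (by linarith)
        rcases lt_max_iff.1 h2 with h4 | h4 <;> linarith
    refine ⟨ν₀, hν₀, hglob, fun ν hν0 hm => huniq ν hν0 (hm ν₀ hν₀), ?_, hpos ν₀ hν₀⟩
    rw [tendsto_order]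
    constructor
    · intro a ha
      set b := max a (ν₀ / 2) with hb
      have hb0 : 0 < b := lt_of_lt_of_le (by positivity) (le_max_right _ _)
      have hbν : b < ν₀ := max_lt ha (by linarith)
      have hVb : reducedPotential α r β 0 ν₀ < reducedPotential α r β 0 b := by
        by_contra hle
        have := huniq b hb0 (not_lt.1 hle)
        linarith
      filter_upwards [hev ν₀ hν₀ _ hVb, self_mem_nhdsWithin] with lam h1 h2
      refine lt_of_le_of_lt (le_max_left a (ν₀ / 2)) ?_
      by_contra hle
      rcases (not_lt.1 hle).lt_or_eq with h3 | h3
      · have := hleft _ _ (hν lam h2).1 h3 hbν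
        linarith
      · rw [h3] at h1
        exact lt_irrefl _ h1
    · intro a ha
      filter_upwards [self_mem_nhdsWithin] with lam h2
      have h2' : 0 < lam := h2
      obtain ⟨h3, h4⟩ := hν lam h2'
      have h5 := h4 ν₀ hν₀
      rw [hlam lam _ h3, hlam lam _ hν₀] at h5
      have h6 := hglob _ h3
      have h7 : νfun lam ^ 2 ≤ ν₀ ^ 2 := by
        have : lam / 2 * νfun lam ^ 2 ≤ lam / 2 * ν₀ ^ 2 := by linarith
        exact le_of_mul_le_mul_left this (by positivity)
      have h8 := (pow_le_pow_iff_left₀ h3.le hν₀.le two_ne_zero).1 h7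
      linarith

end
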